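/- Let (X,T) be a compact dynamical system. Every T-invariant Borel probability measure has a generic point if and only if for every asymptotic average pseudo-orbit {x_i} of X whose set of weak* limit points of empirical measures is a singleton, there exists a point x ∈ X such that lim_{n→∞} min_{σ∈S_n} (1/n) Σ_{i=0}^{n-1} d(x_i, T^{σ(i)} x) = 0. -/

import Mathlib

open MeasureTheory Filter Topology
open scoped ENNReal NNReal

section Defs

variable {X : Type*} [MetricSpace X] [MeasurableSpace X] [BorelSpace X]

/-- Kantorovich–Rubinshtein (dual-Lipschitz) distance between two measures:
the supremum of `|∫ f dμ - ∫ f dν|` over bounded `f` with Lipschitz constant at most `1`. -/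
noncomputable def krDist (μ ν : Measure X) : ℝ :=
  sSup { r : ℝ | ∃ f : X → ℝ, LipschitzWith 1 f ∧ (∃ C, ∀ x, |f x| ≤ C) ∧
    r = |∫ x, f x ∂μ - ∫ x, f x ∂ν| }

/-- Empirical measure of the first `n` terms of a sequence (as a plain measure). -/
noncomputable def empMeas (x : ℕ → X) (n : ℕ) : Measure X :=
  (n : ℝ≥0∞)⁻¹ • ∑ i ∈ Finset.range n, Measure.dirac (x i)

/-- Average of the Dirac measures at the first `max n 1` points of a sequence, as a
probability measure.  For `n ≥ 1` this is the `n`-th empirical measure. -/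
noncomputable def avgDirac (x : ℕ → X) (n : ℕ) : ProbabilityMeasure X :=
  ⟨((max n 1 : ℕ) : ℝ≥0∞)⁻¹ • ∑ i ∈ Finset.range (max n 1), Measure.dirac (x i), by
    constructor
    have h : (∑ i ∈ Finset.range (max n 1), Measure.dirac (x i)) Set.univ
        = ((max n 1 : ℕ) : ℝ≥0∞) := by
      simp [Measure.finset_sum_apply]
    rw [Measure.smul_apply, h, smul_eq_mul]
    exact ENNReal.inv_mul_cancel (by simp) (by simp)⟩

/-- The set of weak* limit points of the empirical measures of a sequence. -/
def limitMeasures (x : ℕ → X) : Set (ProbabilityMeasure X) :=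
  { μ | ∃ φ : ℕ → ℕ, StrictMono φ ∧ Tendsto (fun k => avgDirac x (φ k)) atTop (𝓝 μ) }

/-- `x` is a generic point for `μ`: the empirical measures along the orbit of `x`
converge to `μ` in the weak* topology. -/
def genericFor (T : X → X) (x : X) (μ : ProbabilityMeasure X) : Prop :=
  Tendsto (fun n => avgDirac (fun i => T^[i] x) n) atTop (𝓝 μ)

/-- The invariant measure supported on the periodic orbit of `x` of period `p`. -/
noncomputable def periodicOrbitMeasure (T : X → X) (x : X) (p : ℕ) : ProbabilityMeasure X :=
  avgDirac (fun i => T^[i] x) p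

/-- The set of invariant measures supported on periodic orbits of points of `K`. -/
def perMeasures (T : X → X) (K : Set X) : Set (ProbabilityMeasure X) :=
  { μ | ∃ x ∈ K, ∃ p, 0 < p ∧ T^[p] x = x ∧ μ = periodicOrbitMeasure T x p }

/-- The mean orbital pseudo-metric `Ē`. -/
noncomputable def meanOrbitalDist (T : X → X) (x y : X) : ℝ :=
  limsup (fun n => ⨅ σ : Equiv.Perm (Fin n),
    (∑ i : Fin n, dist (T^[(i : ℕ)] x) (T^[((σ i : Fin n) : ℕ)] y)) / n) atTop

/-- `x` is an asymptotic average pseudo-orbit for `T`. -/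
def IsAAPO (T : X → X) (x : ℕ → X) : Prop :=
  Tendsto (fun n => (∑ i ∈ Finset.range n, dist (T (x i)) (x (i + 1))) / n) atTop (𝓝 0)

/-- The point `x` is `K`-closable. -/
def ClosableAt (T : X → X) (K : Set X) (x : X) : Prop :=
  ∀ ε > (0 : ℝ), ∀ N : ℕ, ∃ p q : ℕ, 0 < p ∧ N ≤ p ∧ p ≤ q ∧ (q : ℝ) ≤ (1 + ε) * p ∧
    ∃ y ∈ K, T^[q] y = y ∧ ∀ i < p, dist (T^[i] y) (T^[i] x) < ε

/-- The set `K ⊆ Per(T)` is linkable. -/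
def Linkable (T : X → X) (K : Set X) : Prop :=
  ∀ y₁ ∈ K, ∀ y₂ ∈ K, ∀ ε > (0 : ℝ), ∀ lam ∈ Set.Icc (0 : ℝ) 1,
    ∃ p₁ p₂ q₁ q₂ : ℕ, 0 < p₁ ∧ 0 < p₂ ∧ T^[p₁] y₁ = y₁ ∧ T^[p₂] y₂ = y₂ ∧
      ∃ z ∈ K, T^[q₂] z = z ∧
        lam - ε ≤ (p₁ : ℝ) / (p₁ + p₂) ∧ (p₁ : ℝ) / (p₁ + p₂) ≤ lam + ε ∧
        p₁ ≤ q₁ ∧ (q₁ : ℝ) ≤ (1 + ε) * p₁ ∧ (∀ i < p₁, dist (T^[i] z) (T^[i] y₁) < ε) ∧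
        p₂ ≤ q₂ - q₁ ∧ ((q₂ - q₁ : ℕ) : ℝ) ≤ (1 + ε) * p₂ ∧
        (∀ i < p₂, dist (T^[i + q₁] z) (T^[i] y₂) < ε)

/-- `(X,T)` has the asymptotic orbital average shadowing property. -/
def AOASP (T : X → X) : Prop :=
  ∀ x : ℕ → X, IsAAPO T x → ∃ z : X,
    Tendsto (fun n => ⨅ σ : Equiv.Perm (Fin n),
      (∑ i : Fin n, dist (x (i : ℕ)) (T^[((σ i : Fin n) : ℕ)] z)) / n) atTop (𝓝 0)

end Defs

theorem integral_avgDirac {X : Type*} [MetricSpace X] [MeasurableSpace X] [BorelSpace X]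
    (f : X → ℝ) (x : ℕ → X) {n : ℕ} (hn : 0 < n) :
    ∫ y, f y ∂(avgDirac x n : Measure X) = (∑ i ∈ Finset.range n, f (x i)) / n := by
  have h : ((avgDirac x n : ProbabilityMeasure X) : Measure X)
      = ((n : ℕ) : ℝ≥0∞)⁻¹ • ∑ i ∈ Finset.range n, Measure.dirac (x i) := by
    simp only [avgDirac, ProbabilityMeasure.coe_mk, max_eq_left (Nat.one_le_iff_ne_zero.2 hn.ne')]
  rw [h, integral_smul_measure, integral_finsetSum_measure]
  · simp [integral_dirac, div_eq_inv_mul]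
  · intro i _
    exact integrable_dirac (by simp)

theorem tendsto_avgDirac_iff {X : Type*} [MetricSpace X] [CompactSpace X]
    [MeasurableSpace X] [BorelSpace X] (x : ℕ → X) (μ : ProbabilityMeasure X) :
    Tendsto (avgDirac x) atTop (𝓝 μ) ↔ ∀ f : X → ℝ, (∃ K, LipschitzWith K f) →
      Tendsto (fun n : ℕ => (∑ i ∈ Finset.range n, f (x i)) / n) atTop (𝓝 (∫ y, f y ∂μ)) := by
  have key (f : X → ℝ) : (fun n : ℕ => ∫ y, f y ∂(avgDirac x n : Measure X)) =ᶠ[atTop]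
      fun n : ℕ => (∑ i ∈ Finset.range n, f (x i)) / n := by
    filter_upwards [eventually_gt_atTop 0] with n hn using integral_avgDirac f x hn
  rw [tendsto_iff_forall_lipschitz_integral_tendsto]
  constructor
  · rintro h f ⟨K, hK⟩
    refine (h f ?_ ⟨K, hK⟩).congr' (key f)
    obtain ⟨C, hC⟩ := Metric.isBounded_iff.1 (isCompact_range hK.continuous).isBounded
    exact ⟨C, fun a b => hC ⟨a, rfl⟩ ⟨b, rfl⟩⟩
  · rintro h f - hf
    exact (h f hf).congr' (key f).symm

theorem tendsto_average_of_tendsto_avgDirac {X : Type*} [MetricSpace X] [CompactSpace X]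
    [MeasurableSpace X] [BorelSpace X] {x : ℕ → X} {μ : ProbabilityMeasure X}
    (h : Tendsto (avgDirac x) atTop (𝓝 μ)) {f : X → ℝ} (hf : Continuous f) :
    Tendsto (fun n : ℕ => (∑ i ∈ Finset.range n, f (x i)) / n) atTop (𝓝 (∫ y, f y ∂μ)) := by
  have := (ProbabilityMeasure.tendsto_iff_forall_integral_tendsto.1 h)
    (BoundedContinuousFunction.mkOfCompact ⟨f, hf⟩)
  refine this.congr' ?_
  filter_upwards [eventually_gt_atTop 0] with n hn using integral_avgDirac f x hn

theorem limitMeasures_eq_singleton_iff {X : Type*} [MetricSpace X] [CompactSpace X]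
    [MeasurableSpace X] [BorelSpace X] {x : ℕ → X} {μ : ProbabilityMeasure X} :
    limitMeasures x = {μ} ↔ Tendsto (avgDirac x) atTop (𝓝 μ) := by
  constructor
  · intro h
    refine tendsto_of_subseq_tendsto fun ns hns => ?_
    obtain ⟨φ, -, hφ⟩ := strictMono_subseq_of_tendsto_atTop hns
    obtain ⟨ν, ψ, hψ, hν⟩ := CompactSpace.tendsto_subseq (fun k => avgDirac x (ns (φ k)))
    have hmem : ν ∈ limitMeasures x := ⟨fun k => ns (φ (ψ k)), hφ.comp hψ, hν⟩
    rw [h, Set.mem_singleton_iff] at hmem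
    exact ⟨φ ∘ ψ, hmem ▸ hν⟩
  · intro h
    ext ν
    constructor
    · rintro ⟨φ, hφ, hν⟩
      exact tendsto_nhds_unique hν (h.comp hφ.tendsto_atTop)
    · rintro rfl
      exact ⟨id, strictMono_id, h⟩

theorem LipschitzWith.tendsto_average_sub {X : Type*} [MetricSpace X] {x y : ℕ → X} {f : X → ℝ}
    {K : ℝ≥0} (hf : LipschitzWith K f)
    (h : Tendsto (fun n => (∑ i ∈ Finset.range n, dist (x i) (y i)) / n) atTop (𝓝 0)) :
    Tendsto (fun n : ℕ => (∑ i ∈ Finset.range n, f (x i)) / n -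
      (∑ i ∈ Finset.range n, f (y i)) / n) atTop (𝓝 0) := by
  refine squeeze_zero_norm (fun n => ?_) (by simpa using h.const_mul (K : ℝ))
  rw [← sub_div, ← Finset.sum_sub_distrib, norm_div, Real.norm_natCast, ← mul_div_assoc]
  gcongr
  rw [Finset.mul_sum]
  exact norm_sum_le_of_le _ fun i _ => hf.dist_le_mul _ _

theorem IsAAPO.map_eq {X : Type*} [MetricSpace X] [CompactSpace X]
    [MeasurableSpace X] [BorelSpace X] {T : X → X} (hT : Continuous T) {x : ℕ → X}
    (hx : IsAAPO T x) {μ : ProbabilityMeasure X} (h : Tendsto (avgDirac x) atTop (𝓝 μ)) :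
    μ.toMeasure.map T = μ.toMeasure := by
  have hlim : Tendsto (fun _ : ℕ => μ.map hT.measurable.aemeasurable) atTop (𝓝 μ) := by
    rw [tendsto_iff_forall_lipschitz_integral_tendsto]
    rintro f - ⟨K, hf⟩
    have h1 := tendsto_average_of_tendsto_avgDirac h (hf.continuous.comp hT)
    have h2 := tendsto_average_of_tendsto_avgDirac h hf.continuous
    have h3 := hf.tendsto_average_sub (x := fun i => T (x i)) (y := fun i => x (i + 1)) hx
    obtain ⟨C, hC⟩ := (isCompact_range hf.continuous).isBounded.exists_norm_le
    have h4 : Tendsto (fun n : ℕ => (∑ i ∈ Finset.range n, f (x (i + 1))) / n -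
        (∑ i ∈ Finset.range n, f (x i)) / n) atTop (𝓝 0) := by
      refine squeeze_zero_norm (fun n => ?_) (tendsto_const_div_atTop_nhds_zero_nat (2 * C))
      rw [← sub_div, ← Finset.sum_sub_distrib, Finset.sum_range_sub (fun i => f (x i)), norm_div,
        Real.norm_natCast]
      gcongr
      linarith [norm_sub_le (f (x n)) (f (x 0)), hC _ ⟨x n, rfl⟩, hC _ ⟨x 0, rfl⟩]
    have h5 : ∫ y, f (T y) ∂(μ : Measure X) = ∫ y, f y ∂(μ : Measure X) := by
      refine tendsto_nhds_unique h1 ?_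
      simpa using (h3.add h4).add h2
    rw [ProbabilityMeasure.toMeasure_map, integral_map hT.measurable.aemeasurable
      hf.continuous.aestronglyMeasurable, h5]
    exact tendsto_const_nhds
  have := tendsto_nhds_unique tendsto_const_nhds hlim
  simpa using congrArg ProbabilityMeasure.toMeasure this

theorem exists_perm_sum_dist_le {X ι : Type*} [MetricSpace X] [Fintype ι] [DecidableEq ι]
    (c : X → ι) {ε D : ℝ} (hε : ∀ x y, c x = c y → dist x y ≤ ε) (hD : ∀ x y : X, dist x y ≤ D)
    {n : ℕ} (a b : Fin n → X) :
    ∃ σ : Equiv.Perm (Fin n), ∑ i, dist (a i) (b (σ i)) ≤ n * ε +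
      D * ∑ k, |(((Finset.univ.filter fun i => c (a i) = k).card : ℝ) -
        (Finset.univ.filter fun i => c (b i) = k).card)| := by
  obtain ⟨σ, hσ⟩ := Finite.exists_min fun σ : Equiv.Perm (Fin n) =>
    (Finset.univ.filter fun i => c (a i) ≠ c (b (σ i))).card
  refine ⟨σ, ?_⟩
  obtain rfl | hn := Nat.eq_zero_or_pos n
  · simp
  have hD0 : 0 ≤ D := dist_nonneg.trans (hD (a ⟨0, hn⟩) (a ⟨0, hn⟩))
  have hε0 : 0 ≤ ε := dist_nonneg.trans (hε (a ⟨0, hn⟩) (a ⟨0, hn⟩) rfl)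
  have swap (i j : Fin n) (hi : c (a i) ≠ c (b (σ i))) (hj : c (a j) ≠ c (b (σ j))) :
      c (a i) ≠ c (b (σ j)) := by
    intro hij
    refine (hσ (σ * Equiv.swap i j)).not_gt (Finset.card_lt_card ?_)
    have hne : i ≠ j := by rintro rfl; exact hi hij
    rw [Finset.ssubset_iff_of_subset]
    · exact ⟨i, by simpa using hi, fun h => (Finset.mem_filter.1 h).2 (by simpa using hij)⟩
    · intro l hl
      replace hl := (Finset.mem_filter.1 hl).2
      refine Finset.mem_filter.2 ⟨Finset.mem_univ _, ?_⟩
      by_cases hli : l = i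
      · exact hli ▸ hi
      by_cases hlj : l = j
      · exact hlj ▸ hj
      rwa [Equiv.Perm.mul_apply, Equiv.swap_apply_of_ne_of_ne hli hlj] at hl
  have count (k : ι) : ((Finset.univ.filter fun i => c (a i) ≠ c (b (σ i)) ∧ c (a i) = k).card : ℝ)
      ≤ |(((Finset.univ.filter fun i => c (a i) = k).card : ℝ) -
        (Finset.univ.filter fun i => c (b i) = k).card)| := by
    by_cases hk : ∃ i, c (a i) ≠ c (b (σ i)) ∧ c (a i) = k
    · obtain ⟨i, hi, rfl⟩ := hk
      have hb : (Finset.univ.filter fun j => c (b j) = c (a i)).card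
          = (Finset.univ.filter fun j => c (a j) = c (b (σ j)) ∧ c (a j) = c (a i)).card := by
        symm
        refine Finset.card_bij (fun j _ => σ j) ?_ (fun _ _ _ _ h => σ.injective h) ?_
        · intro j hj
          simp only [Finset.mem_filter, Finset.mem_univ, true_and] at hj ⊢
          rw [← hj.1, hj.2]
        · intro j hj
          simp only [Finset.mem_filter, Finset.mem_univ, true_and] at hj
          have hm : c (a (σ.symm j)) = c (b (σ (σ.symm j))) := by
            by_contra hm
            exact swap i _ hi hm (by simpa using hj.symm)
          refine ⟨σ.symm j, ?_, by simp⟩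
          simp only [Finset.mem_filter, Finset.mem_univ, true_and]
          exact ⟨hm, hm.trans (by simpa using hj)⟩
      refine le_trans (le_of_eq ?_) (le_abs_self _)
      rw [hb, eq_sub_iff_add_eq]
      norm_cast
      rw [← Finset.card_union_of_disjoint]
      · congr 1
        ext j
        simp only [Finset.mem_union, Finset.mem_filter, Finset.mem_univ, true_and]
        tauto
      · rw [Finset.disjoint_filter]
        tauto
    · push Not at hk
      rw [Finset.filter_false_of_mem fun i _ h => hk i h.1 h.2]
      simp
  calc ∑ i, dist (a i) (b (σ i))
      ≤ ∑ i, (ε + D * ∑ k, if c (a i) ≠ c (b (σ i)) ∧ c (a i) = k then 1 else 0) := by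
        refine Finset.sum_le_sum fun i _ => ?_
        by_cases h : c (a i) = c (b (σ i))
        · simpa [h] using hε _ _ h
        · simpa [h] using (hD _ _).trans (le_add_of_nonneg_left hε0)
    _ = n * ε + D * ∑ k,
        ((Finset.univ.filter fun i => c (a i) ≠ c (b (σ i)) ∧ c (a i) = k).card : ℝ) := by
        rw [Finset.sum_add_distrib, ← Finset.mul_sum, Finset.sum_comm]
        simp
    _ ≤ _ := by gcongr with k; exact count k

theorem exists_finite_partition_null_frontier {X : Type*} [MetricSpace X] [CompactSpace X]
    [MeasurableSpace X] [BorelSpace X] (μ : Measure X) [SFinite μ] {ε : ℝ} (hε : 0 < ε) :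
    ∃ (t : Finset X) (c : X → Set t), (∀ x y, c x = c y → dist x y ≤ ε) ∧
      ∀ k, MeasurableSet (c ⁻¹' {k}) ∧ μ (frontier (c ⁻¹' {k})) = 0 := by
  have hr (x : X) : ∃ r ∈ Set.Ioo 0 (ε / 2), μ (frontier (Metric.ball x r)) = 0 := by
    simpa using exists_null_frontier_thickening μ {x} (half_pos hε)
  choose r hr hμ using hr
  obtain ⟨t, ht⟩ := CompactSpace.elim_nhds_subcover (fun x => Metric.ball x (r x))
    fun x => Metric.ball_mem_nhds x (hr x).1
  refine ⟨t, fun x => {i | x ∈ Metric.ball (i : X) (r i)}, ?_, fun k => ⟨?_, ?_⟩⟩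
  · intro x y hxy
    obtain ⟨i, hi, hx⟩ : ∃ i ∈ t, x ∈ Metric.ball i (r i) := by
      simpa using (ht.ge (Set.mem_univ x))
    have hy : y ∈ Metric.ball i (r i) := (Set.ext_iff.1 hxy ⟨i, hi⟩).1 hx
    have := (hr i).2
    rw [Metric.mem_ball] at hx hy
    linarith [dist_triangle_right x y i]
  · have : (fun x => {i : t | x ∈ Metric.ball (i : X) (r i)}) ⁻¹' {k} =
        ⋂ i : t, {x | x ∈ Metric.ball (i : X) (r i) ↔ i ∈ k} := by
      ext x
      simp [Set.ext_iff]
    rw [this]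
    exact MeasurableSet.iInter fun i => Metric.isOpen_ball.measurableSet.iff (.const _)
  · refine measure_mono_null ?_ ((measure_iUnion_null_iff (ι := t)).2 fun i => hμ i)
    intro x hx
    by_contra hcon
    simp only [Set.mem_iUnion, not_exists] at hcon
    have hloc (i : t) : ∀ᶠ y in 𝓝 x,
        (y ∈ Metric.ball (i : X) (r i) ↔ x ∈ Metric.ball (i : X) (r i)) := by
      have h := hcon i
      by_cases hxi : x ∈ Metric.ball (i : X) (r i)
      · filter_upwards [Metric.isOpen_ball.mem_nhds hxi] with y hy
        exact iff_of_true hy hxi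
      · have : x ∉ closure (Metric.ball (i : X) (r i)) := fun hc =>
          h ⟨hc, fun hi => hxi (interior_subset hi)⟩
        filter_upwards [isClosed_closure.isOpen_compl.mem_nhds this] with y hy
        exact iff_of_false (fun hy' => hy (subset_closure hy')) hxi
    have hall := eventually_all.2 hloc
    have hc : ∀ᶠ y in 𝓝 x, {i : t | y ∈ Metric.ball (i : X) (r i)} =
        {i : t | x ∈ Metric.ball (i : X) (r i)} := by
      filter_upwards [hall] with y hy
      ext i
      exact hy i
    by_cases hk : {i : t | x ∈ Metric.ball (i : X) (r i)} = k
    · refine hx.2 (mem_interior_iff_mem_nhds.2 ?_)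
      filter_upwards [hc] with y hy
      exact hy.trans hk
    · obtain ⟨y, hy, hyk⟩ := (mem_closure_iff_frequently.1 hx.1).and_eventually hc |>.exists
      exact hk (hyk.symm.trans hy)

theorem avgDirac_real_apply {X : Type*} [MetricSpace X] [MeasurableSpace X] [BorelSpace X]
    (x : ℕ → X) {n : ℕ} (hn : 0 < n) {s : Set X} [DecidablePred (· ∈ s)] (hs : MeasurableSet s) :
    (avgDirac x n : Measure X).real s
      = ((Finset.univ.filter fun i : Fin n => x i ∈ s).card : ℝ) / n := by
  have := integral_avgDirac (s.indicator 1) x hn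
  rw [integral_indicator_one hs] at this
  rw [this, Finset.sum_range]
  simp [Set.indicator_apply]

theorem tendsto_iInf_perm_sum_dist {X : Type*} [MetricSpace X] [CompactSpace X]
    [MeasurableSpace X] [BorelSpace X] {x y : ℕ → X} {μ : ProbabilityMeasure X}
    (hx : Tendsto (avgDirac x) atTop (𝓝 μ)) (hy : Tendsto (avgDirac y) atTop (𝓝 μ)) :
    Tendsto (fun n => ⨅ σ : Equiv.Perm (Fin n),
      (∑ i : Fin n, dist (x i) (y (σ i))) / n) atTop (𝓝 0) := by
  classical
  refine tendsto_order.2 ⟨fun a ha => Eventually.of_forall fun n => ha.trans_le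
    (Real.iInf_nonneg fun σ => by positivity), fun ε hε => ?_⟩
  obtain ⟨t, c, hc, hk⟩ := exists_finite_partition_null_frontier (μ : Measure X) (half_pos hε)
  have hD : ∀ a b : X, dist a b ≤ Metric.diam (Set.univ : Set X) := fun a b =>
    Metric.dist_le_diam_of_mem isCompact_univ.isBounded (Set.mem_univ a) (Set.mem_univ b)
  have hlim {z : ℕ → X} (hz : Tendsto (avgDirac z) atTop (𝓝 μ)) (k : Set t) :
      Tendsto (fun n : ℕ => ((Finset.univ.filter fun i : Fin n => c (z i) = k).card : ℝ) / n)
        atTop (𝓝 ((μ : Measure X).real (c ⁻¹' {k}))) := by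
    have h := (ENNReal.tendsto_toReal (measure_ne_top _ _)).comp
      (ProbabilityMeasure.tendsto_measure_of_null_frontier_of_tendsto' hz (hk k).2)
    refine h.congr' ?_
    filter_upwards [eventually_gt_atTop 0] with n hn
    exact avgDirac_real_apply z hn (hk k).1
  have hsum : Tendsto (fun n : ℕ => ε / 2 + Metric.diam (Set.univ : Set X) * ∑ k : Set t,
      |((Finset.univ.filter fun i : Fin n => c (x i) = k).card : ℝ) / n -
        ((Finset.univ.filter fun i : Fin n => c (y i) = k).card : ℝ) / n|) atTop
      (𝓝 (ε / 2)) := by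
    have := tendsto_finsetSum Finset.univ fun k _ => ((hlim hx k).sub (hlim hy k)).abs
    simpa using (this.const_mul (Metric.diam (Set.univ : Set X))).const_add (ε / 2)
  filter_upwards [hsum.eventually_lt_const (half_lt_self hε), eventually_gt_atTop 0] with n hn hn0
  obtain ⟨σ, hσ⟩ := exists_perm_sum_dist_le c hc hD (fun i : Fin n => x i) fun i => y i
  refine (ciInf_le ⟨0, ?_⟩ σ).trans_lt (lt_of_le_of_lt ?_ hn)
  · rintro _ ⟨τ, rfl⟩
    positivity
  have hn' : (0 : ℝ) < n := Nat.cast_pos.2 hn0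
  simp_rw [← sub_div, abs_div, Nat.abs_cast, ← Finset.sum_div]
  rw [div_le_iff₀ hn']
  refine hσ.trans (le_of_eq ?_)
  field_simp

theorem card_filter_sqrt_eq_le (n k : ℕ) :
    ((Finset.range n).filter fun j => k = Nat.sqrt j).card ≤ 2 * k + 1 := by
  calc ((Finset.range n).filter fun j => k = Nat.sqrt j).card
      ≤ (Finset.Ico (k * k) ((k + 1) * (k + 1))).card := by
        refine Finset.card_le_card fun j hj => ?_
        obtain rfl := (Finset.mem_filter.1 hj).2
        exact Finset.mem_Ico.2 ⟨Nat.sqrt_le j, Nat.lt_succ_sqrt j⟩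
    _ = 2 * k + 1 := by
        rw [Nat.card_Ico, Nat.sub_eq_iff_eq_add (by gcongr <;> omega)]
        ring

theorem integral_sq_sum_le_of_sqrt_blocks {Ω : Type*} [MeasurableSpace Ω] {P : Measure Ω}
    [IsProbabilityMeasure P] {Y : ℕ → Ω → ℝ} (hm : ∀ i, Measurable (Y i)) {C : ℝ}
    (hC : ∀ i ω, |Y i ω| ≤ C)
    (h0 : ∀ i j, Nat.sqrt i ≠ Nat.sqrt j → ∫ ω, Y i ω * Y j ω ∂P = 0) (n : ℕ) :
    ∫ ω, (∑ i ∈ Finset.range n, Y i ω) ^ 2 ∂P ≤ n * ((2 * Nat.sqrt n + 1) * C ^ 2) := by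
  have hbd (i j : ℕ) (ω : Ω) : ‖Y i ω * Y j ω‖ ≤ C ^ 2 := by
    rw [norm_mul, sq]
    exact mul_le_mul (hC i ω) (hC j ω) (norm_nonneg _) ((abs_nonneg _).trans (hC i ω))
  have hint (i j : ℕ) : Integrable (fun ω => Y i ω * Y j ω) P :=
    .of_bound ((hm i).mul (hm j)).aestronglyMeasurable (C ^ 2) (.of_forall (hbd i j))
  have hle (i j : ℕ) : ∫ ω, Y i ω * Y j ω ∂P ≤ if Nat.sqrt i = Nat.sqrt j then C ^ 2 else 0 := by
    split_ifs with h
    · have := norm_integral_le_of_norm_le_const (μ := P) (.of_forall (hbd i j))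
      simpa using (le_abs_self _).trans this
    · exact (h0 i j h).le
  simp_rw [sq (∑ i ∈ Finset.range n, Y i _), Finset.sum_mul_sum]
  rw [integral_finsetSum _ fun i _ => integrable_finsetSum _ fun j _ => hint i j]
  simp_rw [integral_finsetSum _ fun j _ => hint _ j]
  calc ∑ i ∈ Finset.range n, ∑ j ∈ Finset.range n, ∫ ω, Y i ω * Y j ω ∂P
      ≤ ∑ i ∈ Finset.range n, ∑ j ∈ Finset.range n,
        if Nat.sqrt i = Nat.sqrt j then C ^ 2 else 0 := by
        gcongr with i _ j _
        exact hle i j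
    _ ≤ ∑ i ∈ Finset.range n, (2 * Nat.sqrt n + 1) * C ^ 2 := by
        refine Finset.sum_le_sum fun i hi => ?_
        rw [← Finset.sum_filter, Finset.sum_const, nsmul_eq_mul]
        gcongr
        have h1 := card_filter_sqrt_eq_le n (Nat.sqrt i)
        have h2 := Nat.sqrt_le_sqrt (Finset.mem_range.1 hi).le
        exact_mod_cast h1.trans (by omega)
    _ = _ := by simp

theorem tendsto_average_zero_of_tendsto_pow_four {y : ℕ → ℝ} {C : ℝ} (hC : ∀ i, |y i| ≤ C)
    (h : Tendsto (fun m : ℕ => (∑ i ∈ Finset.range (m ^ 4), y i) / (m ^ 4 : ℕ)) atTop (𝓝 0)) :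
    Tendsto (fun n : ℕ => (∑ i ∈ Finset.range n, y i) / n) atTop (𝓝 0) := by
  have hC0 : 0 ≤ C := (abs_nonneg _).trans (hC 0)
  have hs : Tendsto Nat.sqrt atTop atTop :=
    tendsto_atTop.2 fun b => (eventually_ge_atTop (b * b)).mono fun n hn => Nat.le_sqrt.2 hn
  have hlim : Tendsto (fun m : ℕ =>
      |(∑ i ∈ Finset.range (m ^ 4), y i) / (m ^ 4 : ℕ)| + 15 * C / m) atTop (𝓝 0) := by
    simpa using h.abs.add (tendsto_const_div_atTop_nhds_zero_nat (15 * C))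
  refine squeeze_zero_norm' ?_ (hlim.comp (hs.comp hs))
  filter_upwards [eventually_gt_atTop 0] with n hn
  simp only [Function.comp_apply]
  have hm0 : 0 < Nat.sqrt (Nat.sqrt n) := Nat.sqrt_pos.2 (Nat.sqrt_pos.2 hn)
  set m := Nat.sqrt (Nat.sqrt n) with hm
  have h1 : m ^ 4 ≤ n := by
    calc m ^ 4 = (m * m) * (m * m) := by ring
      _ ≤ n := (Nat.mul_le_mul (Nat.sqrt_le _) (Nat.sqrt_le _)).trans (Nat.sqrt_le n)
  have h2 : n ≤ (m + 1) ^ 4 := by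
    have h3 : Nat.sqrt n + 1 ≤ (m + 1) * (m + 1) := Nat.lt_succ_sqrt _
    calc n ≤ (Nat.sqrt n + 1) * (Nat.sqrt n + 1) := (Nat.lt_succ_sqrt n).le
      _ ≤ ((m + 1) * (m + 1)) * ((m + 1) * (m + 1)) := Nat.mul_le_mul h3 h3
      _ = (m + 1) ^ 4 := by ring
  have hmR : (1 : ℝ) ≤ m := by exact_mod_cast hm0
  have h1R : (m : ℝ) ^ 4 ≤ n := by exact_mod_cast h1
  have h2R : (n : ℝ) ≤ (m + 1) ^ 4 := by exact_mod_cast h2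
  have hgap : (n : ℝ) - m ^ 4 ≤ 15 * m ^ 3 := by
    nlinarith [mul_nonneg (sub_nonneg.2 hmR) (sq_nonneg (m : ℝ)),
      mul_nonneg (sub_nonneg.2 hmR) (zero_le_one.trans hmR)]
  have hrest : |∑ i ∈ Finset.Ico (m ^ 4) n, y i| ≤ 15 * C * m ^ 3 := by
    calc |∑ i ∈ Finset.Ico (m ^ 4) n, y i| ≤ ∑ i ∈ Finset.Ico (m ^ 4) n, C :=
          (Finset.abs_sum_le_sum_abs _ _).trans (Finset.sum_le_sum fun i _ => hC i)
      _ = ((n : ℝ) - m ^ 4) * C := by simp [Nat.cast_sub h1]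
      _ ≤ 15 * m ^ 3 * C := by gcongr
      _ = _ := by ring
  have hm4 : (0 : ℝ) < (m : ℝ) ^ 4 := by positivity
  rw [← Finset.sum_range_add_sum_Ico _ h1, norm_div, Real.norm_natCast, Real.norm_eq_abs]
  calc _ ≤ (|∑ i ∈ Finset.range (m ^ 4), y i| + 15 * C * m ^ 3) / (m : ℝ) ^ 4 := by
        gcongr
        exact (abs_add_le _ _).trans (by gcongr)
    _ = _ := by
        rw [add_div, abs_div, Nat.abs_cast, Nat.cast_pow]
        congr 1
        field_simp

theorem ae_tendsto_average_zero_of_sqrt_blocks {Ω : Type*} [MeasurableSpace Ω] {P : Measure Ω}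
    [IsProbabilityMeasure P] {Y : ℕ → Ω → ℝ} (hm : ∀ i, Measurable (Y i)) {C : ℝ}
    (hC : ∀ i ω, |Y i ω| ≤ C)
    (h0 : ∀ i j, Nat.sqrt i ≠ Nat.sqrt j → ∫ ω, Y i ω * Y j ω ∂P = 0) :
    ∀ᵐ ω ∂P, Tendsto (fun n : ℕ => (∑ i ∈ Finset.range n, Y i ω) / n) atTop (𝓝 0) := by
  set Z : ℕ → Ω → ℝ := fun m ω =>
    ((∑ i ∈ Finset.range (m ^ 4), Y i ω) / (m ^ 4 : ℕ)) ^ 2 with hZ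
  have hZm (m : ℕ) : Measurable (Z m) := by fun_prop
  have hZi (m : ℕ) : ∫ ω, Z m ω ∂P ≤ 3 * C ^ 2 * (1 / (m : ℝ) ^ 2) := by
    obtain rfl | hm0 := Nat.eq_zero_or_pos m
    · simp [hZ]
    have hmR : (1 : ℝ) ≤ m := by exact_mod_cast hm0
    have hsq : Nat.sqrt (m ^ 4) = m ^ 2 := by
      rw [show m ^ 4 = m ^ 2 * m ^ 2 by ring, Nat.sqrt_eq]
    have h := integral_sq_sum_le_of_sqrt_blocks hm hC h0 (m ^ 4)
    rw [hsq] at h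
    simp only [hZ, div_pow]
    rw [integral_div, div_le_iff₀ (by positivity)]
    refine h.trans ?_
    push_cast
    have : 2 * (m : ℝ) ^ 2 + 1 ≤ 3 * m ^ 2 := by nlinarith
    calc (m : ℝ) ^ 4 * ((2 * m ^ 2 + 1) * C ^ 2) ≤ m ^ 4 * (3 * m ^ 2 * C ^ 2) := by gcongr
      _ = _ := by field_simp
  have hsum : Summable fun m => ∫ ω, Z m ω ∂P :=
    .of_nonneg_of_le (fun m => integral_nonneg fun ω => sq_nonneg _) hZi
      ((Real.summable_one_div_nat_pow.2 one_lt_two).mul_left _)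
  have hZint (m : ℕ) : Integrable (Z m) P := by
    refine .of_bound (hZm m).aestronglyMeasurable (C ^ 2) (.of_forall fun ω => ?_)
    rw [hZ, norm_pow, norm_div, Real.norm_natCast]
    refine pow_le_pow_left₀ (by positivity) (div_le_of_le_mul₀ (by positivity)
      ((abs_nonneg _).trans (hC 0 ω)) ?_) 2
    refine (norm_sum_le_of_le _ fun i _ => hC i ω).trans (le_of_eq ?_)
    simp [mul_comm]
  have hfin : ∑' m, ∫⁻ ω, ENNReal.ofReal (Z m ω) ∂P ≠ ∞ := by
    simp_rw [← ofReal_integral_eq_lintegral_ofReal (hZint _) (.of_forall fun ω => sq_nonneg _)]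
    exact hsum.tsum_ofReal_ne_top
  rw [← lintegral_tsum fun m => (hZm m).ennreal_ofReal.aemeasurable] at hfin
  filter_upwards [ae_lt_top (.tsum fun m => (hZm m).ennreal_ofReal) hfin] with ω hω
  refine tendsto_average_zero_of_tendsto_pow_four (fun i => hC i ω) ?_
  have h1 := (ENNReal.tendsto_toReal ENNReal.zero_ne_top).comp
    (ENNReal.tendsto_atTop_zero_of_tsum_ne_top hω.ne)
  have h2 : Tendsto (fun m => Z m ω) atTop (𝓝 0) :=
    h1.congr fun m => ENNReal.toReal_ofReal (sq_nonneg _)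
  rw [tendsto_zero_iff_abs_tendsto_zero]
  simpa [hZ, Real.sqrt_sq_eq_abs, Function.comp_def] using h2.sqrt

theorem tendsto_avgDirac_of_tendsto_iInf_perm {X : Type*} [MetricSpace X] [CompactSpace X]
    [MeasurableSpace X] [BorelSpace X] {x y : ℕ → X} {μ : ProbabilityMeasure X}
    (hx : Tendsto (avgDirac x) atTop (𝓝 μ))
    (h : Tendsto (fun n => ⨅ σ : Equiv.Perm (Fin n),
      (∑ i : Fin n, dist (x i) (y (σ i))) / n) atTop (𝓝 0)) :
    Tendsto (avgDirac y) atTop (𝓝 μ) := by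
  rw [tendsto_avgDirac_iff] at hx ⊢
  rintro f ⟨K, hf⟩
  have hdiff : Tendsto (fun n : ℕ => (∑ i ∈ Finset.range n, f (x i)) / n -
      (∑ i ∈ Finset.range n, f (y i)) / n) atTop (𝓝 0) := by
    refine squeeze_zero_norm (fun n => ?_) (by simpa using h.const_mul (K : ℝ))
    obtain ⟨σ, hσ⟩ := exists_eq_ciInf_of_finite (f := fun σ : Equiv.Perm (Fin n) =>
      (∑ i : Fin n, dist (x i) (y (σ i))) / n)
    rw [← hσ, ← sub_div, Finset.sum_range, Finset.sum_range,
      ← Equiv.sum_comp σ (fun i : Fin n => f (y i)), ← Finset.sum_sub_distrib, norm_div,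
      Real.norm_natCast, ← mul_div_assoc, Finset.mul_sum]
    gcongr
    exact norm_sum_le_of_le _ fun i _ => hf.dist_le_mul _ _
  simpa using (hx f ⟨K, hf⟩).sub hdiff

/-- The pseudo-orbit that jumps to `ω k` at time `k ^ 2` and follows the orbit of `ω k` until
time `(k + 1) ^ 2`. -/
def squareBlockOrbit {X : Type*} (T : X → X) (ω : ℕ → X) (i : ℕ) : X :=
  T^[i - Nat.sqrt i * Nat.sqrt i] (ω (Nat.sqrt i))

theorem isAAPO_squareBlockOrbit {X : Type*} [MetricSpace X] [CompactSpace X] (T : X → X)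
    (ω : ℕ → X) : IsAAPO T (squareBlockOrbit T ω) := by
  set D := Metric.diam (Set.univ : Set X)
  have hD : ∀ a b : X, dist a b ≤ D := fun a b =>
    Metric.dist_le_diam_of_mem isCompact_univ.isBounded (Set.mem_univ a) (Set.mem_univ b)
  have hD0 : 0 ≤ D := Metric.diam_nonneg
  have hs : Tendsto Nat.sqrt atTop atTop :=
    tendsto_atTop.2 fun b => (eventually_ge_atTop (b * b)).mono fun n hn => Nat.le_sqrt.2 hn
  have hstep (i : ℕ) : dist (T (squareBlockOrbit T ω i)) (squareBlockOrbit T ω (i + 1)) ≤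
      D * (Nat.sqrt (i + 1)) - D * (Nat.sqrt i) := by
    obtain h | h := (Nat.sqrt_le_sqrt (Nat.le_succ i)).eq_or_lt
    · have : i + 1 - Nat.sqrt i * Nat.sqrt i = (i - Nat.sqrt i * Nat.sqrt i) + 1 :=
        Nat.sub_add_comm (Nat.sqrt_le i)
      have heq : squareBlockOrbit T ω (i + 1) = T (squareBlockOrbit T ω i) := by
        rw [squareBlockOrbit, squareBlockOrbit, ← h, this, Function.iterate_succ_apply']
      simp [heq, ← h]
    · have : (Nat.sqrt i : ℝ) + 1 ≤ Nat.sqrt (i + 1) := by exact_mod_cast h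
      nlinarith [hD (T (squareBlockOrbit T ω i)) (squareBlockOrbit T ω (i + 1))]
  refine squeeze_zero' (.of_forall fun n => by positivity) ?_
    ((tendsto_const_div_atTop_nhds_zero_nat D).comp hs)
  filter_upwards [eventually_gt_atTop 0] with n hn
  have hs0 : (0 : ℝ) < Nat.sqrt n := Nat.cast_pos.2 (Nat.sqrt_pos.2 hn)
  have hsum : ∑ i ∈ Finset.range n,
      dist (T (squareBlockOrbit T ω i)) (squareBlockOrbit T ω (i + 1)) ≤ D * Nat.sqrt n := by
    refine (Finset.sum_le_sum fun i _ => hstep i).trans (le_of_eq ?_)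
    rw [Finset.sum_range_sub fun i => D * (Nat.sqrt i : ℝ)]
    simp
  have hle : (Nat.sqrt n : ℝ) * Nat.sqrt n ≤ n := by exact_mod_cast Nat.sqrt_le n
  simp only [Function.comp_apply]
  rw [div_le_div_iff₀ (Nat.cast_pos.2 hn) hs0]
  nlinarith

theorem ae_tendsto_average_squareBlockOrbit {X : Type*} [MetricSpace X] [CompactSpace X]
    [MeasurableSpace X] [BorelSpace X] {T : X → X} {μ : Measure X} [IsProbabilityMeasure μ]
    (hT : MeasurePreserving T μ μ) (f : C(X, ℝ)) :
    ∀ᵐ ω ∂Measure.infinitePi (fun _ : ℕ => μ), Tendsto (fun n : ℕ =>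
      (∑ i ∈ Finset.range n, f (squareBlockOrbit T ω i)) / n) atTop (𝓝 (∫ y, f y ∂μ)) := by
  set P := Measure.infinitePi fun _ : ℕ => μ
  set c := ∫ y, f y ∂μ with hc
  have hfm : Measurable f := f.continuous.measurable
  have hmp (i : ℕ) : MeasurePreserving (fun ω => squareBlockOrbit T ω i) P μ :=
    (hT.iterate _).comp (measurePreserving_eval_infinitePi (fun _ : ℕ => μ) _)
  have hm (i : ℕ) : Measurable fun ω => f (squareBlockOrbit T ω i) - c :=
    (hfm.comp (hmp i).measurable).sub_const c
  have hint : Integrable f μ :=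
    .of_bound hfm.aestronglyMeasurable ‖f‖ (.of_forall f.norm_coe_le_norm)
  have hmean (i : ℕ) : ∫ ω, (f (squareBlockOrbit T ω i) - c) ∂P = 0 := by
    rw [← integral_map (f := fun y => f y - c) (hmp i).aemeasurable
      (hfm.sub_const c).aestronglyMeasurable, (hmp i).map_eq,
      integral_sub hint (integrable_const c)]
    simp [hc]
  have hbd (i : ℕ) (ω : ℕ → X) : |f (squareBlockOrbit T ω i) - c| ≤ ‖f‖ + |c| :=
    (abs_sub _ _).trans (by gcongr; exact f.norm_coe_le_norm _)
  have hind := ProbabilityTheory.iIndepFun_infinitePi (P := fun _ : ℕ => μ)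
    (X := fun _ x => x) fun _ => measurable_id
  have h0 (i j : ℕ) (hij : Nat.sqrt i ≠ Nat.sqrt j) :
      ∫ ω, (f (squareBlockOrbit T ω i) - c) * (f (squareBlockOrbit T ω j) - c) ∂P = 0 := by
    have hg (k : ℕ) : Measurable fun y => f (T^[k] y) - c :=
      (hfm.comp (hT.measurable.iterate k)).sub_const c
    have := (hind.indepFun hij).comp (hg (i - Nat.sqrt i * Nat.sqrt i))
      (hg (j - Nat.sqrt j * Nat.sqrt j))
    refine (this.integral_fun_mul_eq_mul_integral (hm i).aestronglyMeasurable
      (hm j).aestronglyMeasurable).trans ?_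
    exact mul_eq_zero_of_left (hmean i) _
  filter_upwards [ae_tendsto_average_zero_of_sqrt_blocks hm hbd h0] with ω hω
  refine tendsto_sub_nhds_zero_iff.1 (hω.congr' ?_)
  filter_upwards [eventually_gt_atTop 0] with n hn
  have : (n : ℝ) ≠ 0 := by positivity
  simp [Finset.sum_sub_distrib, sub_div, this]

theorem tendsto_avgDirac_of_denseRange {X : Type*} [MetricSpace X] [CompactSpace X]
    [MeasurableSpace X] [BorelSpace X] {x : ℕ → X} {μ : ProbabilityMeasure X} {ι : Type*}
    {F : ι → C(X, ℝ)} (hF : DenseRange F)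
    (h : ∀ k, Tendsto (fun n : ℕ => (∑ i ∈ Finset.range n, F k (x i)) / n) atTop
      (𝓝 (∫ y, F k y ∂μ))) :
    Tendsto (avgDirac x) atTop (𝓝 μ) := by
  rw [tendsto_avgDirac_iff]
  rintro f ⟨K, hf⟩
  set g : C(X, ℝ) := ⟨f, hf.continuous⟩
  have hint (g : C(X, ℝ)) : Integrable g (μ : Measure X) :=
    .of_bound g.continuous.measurable.aestronglyMeasurable ‖g‖ (.of_forall g.norm_coe_le_norm)
  rw [Metric.tendsto_atTop']
  intro ε hε
  obtain ⟨k, hk⟩ := hF.exists_dist_lt g (show 0 < ε / 3 by positivity)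
  have hclose (y : X) : ‖f y - F k y‖ ≤ ε / 3 :=
    (ContinuousMap.dist_apply_le_dist (f := g) (g := F k) y).trans hk.le
  obtain ⟨N, hN⟩ := Metric.tendsto_atTop'.1 (h k) (ε / 3) (by positivity)
  refine ⟨N, fun n hn => ?_⟩
  have h1 := hN n hn
  have hn0 : (0 : ℝ) < n := Nat.cast_pos.2 (Nat.zero_lt_of_lt hn)
  have h2 : |(∑ i ∈ Finset.range n, f (x i)) / n - (∑ i ∈ Finset.range n, F k (x i)) / n|
      ≤ ε / 3 := by
    rw [← sub_div, ← Finset.sum_sub_distrib, abs_div, Nat.abs_cast, div_le_iff₀ hn0]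
    refine (norm_sum_le_of_le _ fun i _ => hclose (x i)).trans (le_of_eq ?_)
    simp [mul_comm]
  have h3 : |∫ y, f y ∂(μ : Measure X) - ∫ y, F k y ∂(μ : Measure X)| ≤ ε / 3 := by
    have hfi : Integrable f (μ : Measure X) := hint g
    rw [← integral_sub hfi (hint (F k))]
    simpa using norm_integral_le_of_norm_le_const (μ := (μ : Measure X)) (.of_forall hclose)
  rw [Real.dist_eq] at h1 ⊢
  rw [abs_lt] at h1 ⊢
  rw [abs_le] at h2 h3
  constructor <;> linarith [h1.1, h1.2, h2.1, h2.2, h3.1, h3.2]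

theorem exists_isAAPO_tendsto_avgDirac {X : Type*} [MetricSpace X] [CompactSpace X]
    [MeasurableSpace X] [BorelSpace X] {T : X → X} (μ : ProbabilityMeasure X)
    (hT : MeasurePreserving T (μ : Measure X) μ) :
    ∃ x : ℕ → X, IsAAPO T x ∧ Tendsto (avgDirac x) atTop (𝓝 μ) := by
  obtain ⟨F, hF⟩ := TopologicalSpace.exists_dense_seq C(X, ℝ)
  have hae : ∀ᵐ ω ∂(Measure.infinitePi fun _ : ℕ => (μ : Measure X)), ∀ k, Tendsto (fun n : ℕ =>
      (∑ i ∈ Finset.range n, F k (squareBlockOrbit T ω i)) / n) atTop (𝓝 (∫ y, F k y ∂μ)) := by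
    rw [ae_all_iff]
    intro k
    exact ae_tendsto_average_squareBlockOrbit hT (F k)
  obtain ⟨ω, hω⟩ := hae.exists
  exact ⟨squareBlockOrbit T ω, isAAPO_squareBlockOrbit T ω,
    tendsto_avgDirac_of_denseRange hF hω⟩

theorem stmt19 {X : Type*} [MetricSpace X] [CompactSpace X]
    [MeasurableSpace X] [BorelSpace X]
    (T : X → X) (hT : Continuous T) :
    (∀ μ : ProbabilityMeasure X, μ.toMeasure.map T = μ.toMeasure →
        ∃ z : X, genericFor T z μ) ↔
      (∀ x : ℕ → X, IsAAPO T x → (∃ μ : ProbabilityMeasure X, limitMeasures x = {μ}) →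
        ∃ z : X, Tendsto (fun n => ⨅ σ : Equiv.Perm (Fin n),
          (∑ i : Fin n, dist (x (i : ℕ)) (T^[((σ i : Fin n) : ℕ)] z)) / n) atTop (𝓝 0)) := by
  constructor
  · rintro h x hx ⟨μ, hμ⟩
    rw [limitMeasures_eq_singleton_iff] at hμ
    obtain ⟨z, hz⟩ := h μ (hx.map_eq hT hμ)
    exact ⟨z, tendsto_iInf_perm_sum_dist (y := fun i => T^[i] z) hμ hz⟩
  · intro h μ hμ
    obtain ⟨x, hx, hxμ⟩ := exists_isAAPO_tendsto_avgDirac μ ⟨hT.measurable, hμ⟩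
    obtain ⟨z, hz⟩ := h x hx ⟨μ, limitMeasures_eq_singleton_iff.2 hxμ⟩
    exact ⟨z, tendsto_avgDirac_of_tendsto_iInf_perm (y := fun i => T^[i] z) hxμ hz⟩
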